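/- There exists a family of strings on which the number of left-extensions of maximal substrings is asymptotically the square of the number of right-extensions: for every k ≥ 1 there exists a string T over ℕ of length n = (k+1)(k+2)/2 such that e_L(T) ≥ n and e_R(T) = 4k − 1, so that e_R(T)² ≤ 32·n. Hence there are strings of length n with e_L(T) = Θ(n) and e_R(T) = Θ(√n). -/

import Mathlib

def Substr {α : Type*} (T w : List α) : Prop := ∃ x z : List α, T = x ++ w ++ z

def RightM {α : Type*} (T : List α) : Set (List α) :=
  {w | Substr T w ∧ ((∃ a b : α, a ≠ b ∧ Substr T (w ++ [a]) ∧ Substr T (w ++ [b])) ∨ w <:+ T)}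

def LeftM {α : Type*} (T : List α) : Set (List α) :=
  {w | Substr T w ∧ ((∃ a b : α, a ≠ b ∧ Substr T (a :: w) ∧ Substr T (b :: w)) ∨ w <+: T)}

def MaxSub {α : Type*} (T : List α) : Set (List α) := LeftM T ∩ RightM T

noncomputable def eR {α : Type*} (T : List α) : ℕ :=
  {p : List α × α | p.1 ∈ MaxSub T ∧ Substr T (p.1 ++ [p.2])}.ncard

noncomputable def eL {α : Type*} (T : List α) : ℕ :=
  {p : α × List α | p.2 ∈ MaxSub T ∧ Substr T (p.1 :: p.2)}.ncard

lemma substr_iff_isInfix {α : Type*} {T w : List α} : Substr T w ↔ w <:+: T :=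
  ⟨fun ⟨x, z, h⟩ => ⟨x, z, h.symm⟩, fun ⟨x, z, h⟩ => ⟨x, z, h.symm⟩⟩

/-- A factor containing a letter that occurs only once has a unique occurrence. -/
lemma append_inj_of_count_eq_one {α : Type*} [DecidableEq α] {T w x x' z z' : List α} {c : α}
    (hc : T.count c = 1) (hw : c ∈ w) (h : x ++ w ++ z = T) (h' : x' ++ w ++ z' = T) :
    x = x' ∧ z = z' := by
  obtain ⟨u, v, rfl⟩ := List.append_of_mem hw
  have key : ∀ y s : List α, y ++ (u ++ c :: v) ++ s = T → T.idxOf c = y.length + u.length := by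
    rintro y s rfl
    simp only [List.count_append, List.count_cons_self] at hc
    have hy : c ∉ y := List.count_eq_zero.mp (by omega)
    have hu : c ∉ u := List.count_eq_zero.mp (by omega)
    simp [List.idxOf_append, hy, hu, Nat.add_comm]
  have hlen : x.length = x'.length := by
    have h1 := key x z h
    have h2 := key x' z' h'
    omega
  have heq := h.trans h'.symm
  rw [List.append_assoc, List.append_assoc x'] at heq
  obtain ⟨hx, hz⟩ := List.append_inj heq hlen
  exact ⟨hx, List.append_cancel_left hz⟩

/-- The ascending run `1, 3, …, 2 * m - 1` of odd letters. -/
def oddRun (m : ℕ) : List ℕ := List.range' 1 m 2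

/-- The concatenation of the blocks `oddRun i ++ [2 * i]` for `i = 0, …, k`: the runs are
separated by pairwise distinct even letters. -/
def stair : ℕ → List ℕ
  | 0 => [0]
  | k + 1 => stair k ++ (oddRun (k + 1) ++ [2 * (k + 1)])

/-- `StairStep a b` holds for consecutive letters `a`, `b` of `stair k`. -/
def StairStep (a b : ℕ) : Prop := (a % 2 = 1 ∧ (b = a + 1 ∨ b = a + 2)) ∨ (a % 2 = 0 ∧ b = 1)

lemma oddRun_succ (m : ℕ) : oddRun (m + 1) = oddRun m ++ [2 * m + 1] := by
  rw [oddRun, List.range'_concat, Nat.add_comm]; rfl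

lemma oddRun_succ_eq_cons (m : ℕ) : oddRun (m + 1) = 1 :: List.range' 3 m 2 := by
  rw [oddRun, List.range'_succ]

@[simp] lemma length_oddRun (m : ℕ) : (oddRun m).length = m := by simp [oddRun]

lemma oddRun_injective : Function.Injective oddRun := fun a b h => by
  simpa using congrArg List.length h

lemma mem_oddRun {m a : ℕ} : a ∈ oddRun m ↔ a % 2 = 1 ∧ a < 2 * m := by
  simp only [oddRun, List.mem_range']
  constructor
  · rintro ⟨i, hi, rfl⟩; omega
  · rintro ⟨h, h'⟩; exact ⟨a / 2, by omega, by omega⟩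

lemma oddRun_isPrefix {m n : ℕ} (h : m ≤ n) : oddRun m <+: oddRun n := by
  induction n, h using Nat.le_induction with
  | base => exact List.prefix_refl _
  | succ n _ ih => rw [oddRun_succ]; exact ih.trans (List.prefix_append _ _)

lemma eq_range'_of_isChain {s : ℕ} {t : List ℕ} (h : (s :: t).IsChain StairStep)
    (hodd : ∀ a ∈ s :: t, a % 2 = 1) : s :: t = List.range' s (t.length + 1) 2 := by
  induction t generalizing s with
  | nil => simp
  | cons b t ih =>
    rw [List.isChain_cons_cons] at h
    have hs := hodd s (by simp)
    have hb := hodd b (by simp)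
    obtain rfl : b = s + 2 := by
      rcases h.1 with h | h <;> omega
    rw [ih h.2 fun a ha => hodd a (List.mem_cons_of_mem _ ha)]
    simp [List.range'_succ]

lemma length_stair (k : ℕ) : 2 * (stair k).length = (k + 1) * (k + 2) := by
  induction k with
  | zero => simp [stair]
  | succ k ih => simp only [stair, List.length_append, length_oddRun, List.length_singleton]; linarith

lemma mem_stair {k a : ℕ} : a ∈ stair k ↔ a < 2 * k + 1 := by
  induction k with
  | zero => simp [stair]
  | succ k ih => simp only [stair, List.mem_append, ih, mem_oddRun, List.mem_singleton]; omega

lemma singleton_isInfix_stair {k a : ℕ} (h : a < 2 * k + 1) : [a] <:+: stair k := by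
  obtain ⟨x, z, hxz⟩ := List.append_of_mem (mem_stair.mpr h)
  exact ⟨x, z, by simp [hxz]⟩

lemma count_stair (k i : ℕ) : (stair k).count (2 * i) = if i ≤ k then 1 else 0 := by
  induction k with
  | zero =>
    simp [stair, List.count_singleton]
  | succ k ih =>
    have h : 2 * i ∉ oddRun (k + 1) := by rw [mem_oddRun]; omega
    simp only [stair, List.count_append, ih, List.count_eq_zero.mpr h, List.count_singleton,
      beq_iff_eq]
    split_ifs <;> omega

lemma exists_stair_eq_append (k : ℕ) : ∃ x, stair k = x ++ [2 * k] := by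
  cases k with
  | zero => exact ⟨[], rfl⟩
  | succ k => exact ⟨stair k ++ oddRun (k + 1), by simp [stair]⟩

lemma exists_stair_eq_cons (k : ℕ) : ∃ x, stair k = 0 :: x := by
  induction k with
  | zero => exact ⟨[], rfl⟩
  | succ k ih => obtain ⟨x, hx⟩ := ih; simp [stair, hx]

lemma stair_isPrefix {i k : ℕ} (h : i ≤ k) : stair i <+: stair k := by
  induction k, h using Nat.le_induction with
  | base => exact List.prefix_refl _
  | succ n _ ih => exact ih.trans (List.prefix_append _ _)

lemma isChain_oddRun (m : ℕ) : (oddRun m).IsChain StairStep := by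
  induction m with
  | zero => simp [oddRun]
  | succ m ih =>
    rw [oddRun_succ]
    refine ih.append (List.isChain_singleton _) ?_
    cases m with
    | zero => simp [oddRun]
    | succ m => simp [oddRun_succ, StairStep]; omega

lemma isChain_stair (k : ℕ) : (stair k).IsChain StairStep := by
  induction k with
  | zero => simp [stair]
  | succ k ih =>
    refine ih.append ((isChain_oddRun _).append (List.isChain_singleton _) ?_) ?_
    · simp [oddRun_succ, StairStep]; omega
    · obtain ⟨x, hx⟩ := exists_stair_eq_append k
      simp [hx, oddRun_succ_eq_cons, StairStep]

lemma stairStep_of_isInfix {k a b : ℕ} (h : [a, b] <:+: stair k) : StairStep a b := by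
  simpa using (isChain_stair k).infix h

lemma oddRun_append_even_isInfix {m k : ℕ} (h : m ≤ k) : oddRun m ++ [2 * m] <:+: stair k := by
  refine List.IsInfix.trans ?_ (stair_isPrefix h).isInfix
  cases m with
  | zero => simp [stair, oddRun]
  | succ m => exact (List.suffix_append _ _).isInfix

lemma even_cons_oddRun_isInfix {m i k : ℕ} (hm : m ≤ i + 1) (hi : i < k) :
    2 * i :: oddRun m <:+: stair k := by
  refine List.IsInfix.trans ?_ (stair_isPrefix (Nat.succ_le_of_lt hi)).isInfix
  obtain ⟨x, hx⟩ := exists_stair_eq_append i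
  obtain ⟨y, hy⟩ := oddRun_isPrefix hm
  exact ⟨x, y ++ [2 * (i + 1)], by simp [stair, hx, ← hy]⟩

lemma oddRun_append_odd_isInfix {m k : ℕ} (h : m < k) : oddRun m ++ [2 * m + 1] <:+: stair k := by
  rw [← oddRun_succ]
  exact (List.suffix_cons _ _).isInfix.trans (even_cons_oddRun_isInfix le_rfl h)

lemma oddRun_mem_maxSub {m k : ℕ} (h : m < k) : oddRun m ∈ MaxSub (stair k) := by
  have hsub : Substr (stair k) (oddRun m) := substr_iff_isInfix.mpr
    ((List.prefix_append _ _).isInfix.trans (oddRun_append_even_isInfix h.le))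
  refine ⟨⟨hsub, ?_⟩, hsub, ?_⟩
  · cases m with
    | zero => exact Or.inr List.nil_prefix
    | succ m =>
      exact Or.inl ⟨2 * m, 2 * (m + 1), by omega,
        substr_iff_isInfix.mpr (even_cons_oddRun_isInfix le_rfl (by omega)),
        substr_iff_isInfix.mpr (even_cons_oddRun_isInfix (by omega) h)⟩
  · exact Or.inl ⟨2 * m, 2 * m + 1, by omega,
      substr_iff_isInfix.mpr (oddRun_append_even_isInfix h.le),
      substr_iff_isInfix.mpr (oddRun_append_odd_isInfix h)⟩

/-- A factor with an even letter that is both left- and right-maximal is the whole string. -/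
lemma eq_stair_of_even_mem {k e : ℕ} {w : List ℕ} (hw : w ∈ MaxSub (stair k)) (he : e ∈ w)
    (heven : e % 2 = 0) : w = stair k := by
  obtain ⟨⟨hsub, hl⟩, -, hr⟩ := hw
  have hcount : (stair k).count e = 1 := by
    have hmem := mem_stair.mp ((substr_iff_isInfix.mp hsub).subset he)
    rw [show e = 2 * (e / 2) by omega, count_stair, if_pos (by omega)]
  have hpre : w <+: stair k := by
    refine hl.resolve_left ?_
    rintro ⟨a, b, hab, ⟨x, z, h⟩, ⟨x', z', h'⟩⟩
    have := (append_inj_of_count_eq_one (x := x ++ [a]) (x' := x' ++ [b]) (z := z) (z' := z')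
      hcount he (by simp [h]) (by simp [h'])).1
    exact hab (by simpa using (List.append_inj' this rfl).2)
  have hsuf : w <:+ stair k := by
    refine hr.resolve_left ?_
    rintro ⟨a, b, hab, ⟨x, z, h⟩, ⟨x', z', h'⟩⟩
    have := (append_inj_of_count_eq_one (x := x) (x' := x') (z := a :: z) (z' := b :: z')
      hcount he (by simp [h]) (by simp [h'])).2
    exact hab (by simpa using (List.cons.inj this).1)
  obtain ⟨z, hz⟩ := hpre
  obtain ⟨x, hx⟩ := hsuf
  obtain ⟨-, rfl⟩ := append_inj_of_count_eq_one (x := []) (x' := x) (z := z) (z' := [])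
    hcount he (by simpa using hz) (by simpa using hx)
  simpa using hz

lemma right_extension_of_mem_maxSub {k c : ℕ} {w : List ℕ} (hk : 1 ≤ k)
    (hw : w ∈ MaxSub (stair k)) (hc : w ++ [c] <:+: stair k) :
    ∃ m < k, w = oddRun m ∧ (m = 0 ∨ c = 2 * m ∨ c = 2 * m + 1) := by
  have hodd : ∀ a ∈ w, a % 2 = 1 := by
    intro a ha
    by_contra h
    have := hc.length_le
    simp [eq_stair_of_even_mem hw ha (by omega)] at this
  cases w with
  | nil => exact ⟨0, hk, rfl, Or.inl rfl⟩
  | cons s t =>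
    have hs := hodd s (by simp)
    obtain ⟨⟨hsub, hl⟩, -, hr⟩ := hw
    rw [substr_iff_isInfix] at hsub
    obtain rfl : s = 1 := by
      rcases hl with ⟨a, b, hab, ha, hb⟩ | ⟨z, hz⟩
      · rw [substr_iff_isInfix] at ha hb
        have key : ∀ d, d :: s :: t <:+: stair k → StairStep d s := fun d hd =>
          stairStep_of_isInfix (List.IsInfix.trans ⟨[], t, rfl⟩ hd)
        rcases key a ha with h | h <;> rcases key b hb with h' | h' <;> omega
      · obtain ⟨x, hx⟩ := exists_stair_eq_cons k
        simp only [hx, List.cons_append, List.cons.injEq] at hz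
        omega
    have hrun : 1 :: t = oddRun (t.length + 1) :=
      eq_range'_of_isChain ((isChain_stair k).infix hsub) hodd
    have hstep : ∀ d, 1 :: t ++ [d] <:+: stair k →
        d = 2 * (t.length + 1) ∨ d = 2 * (t.length + 1) + 1 := by
      intro d hd
      have : StairStep (2 * t.length + 1) d := by
        rw [hrun, oddRun_succ] at hd
        exact stairStep_of_isInfix (List.IsInfix.trans ⟨oddRun t.length, [], by simp⟩ hd)
      rcases this with h | h <;> omega
    refine ⟨t.length + 1, ?_, hrun, Or.inr (hstep c hc)⟩
    rcases hr with ⟨a, b, hab, ha, hb⟩ | ⟨x, hx⟩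
    · rw [substr_iff_isInfix] at ha hb
      have ha' := mem_stair.mp (ha.subset (List.mem_append_right _ (List.mem_singleton_self a)))
      have hb' := mem_stair.mp (hb.subset (List.mem_append_right _ (List.mem_singleton_self b)))
      have := hstep a ha
      have := hstep b hb
      omega
    · obtain ⟨y, hy⟩ := exists_stair_eq_append k
      rw [hrun, oddRun_succ, hy, ← List.append_assoc] at hx
      have := List.cons.inj (List.append_inj' hx rfl).2
      omega

lemma eR_stair {k : ℕ} (hk : 1 ≤ k) : eR (stair k) = 4 * k - 1 := by
  let E : Finset (Σ _ : ℕ, ℕ) := (Finset.range k).sigma fun m =>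
    if m = 0 then Finset.range (2 * k + 1) else {2 * m, 2 * m + 1}
  have hinj : Function.Injective fun p : Σ _ : ℕ, ℕ => (oddRun p.1, p.2) := by
    rintro ⟨a, b⟩ ⟨a', b'⟩ h
    simp only [Prod.mk.injEq, oddRun_injective.eq_iff] at h
    rw [h.1, h.2]
  have hE : {p : List ℕ × ℕ | p.1 ∈ MaxSub (stair k) ∧ Substr (stair k) (p.1 ++ [p.2])} =
      ↑(E.map ⟨_, hinj⟩) := by
    ext ⟨w, c⟩
    simp only [substr_iff_isInfix, Set.mem_ofPred_eq, Finset.coe_map, Function.Embedding.coeFn_mk,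
      Set.mem_image, Finset.mem_coe, E, Finset.mem_sigma, Finset.mem_range, Prod.mk.injEq]
    constructor
    · rintro ⟨hw, hc⟩
      obtain ⟨m, hm, rfl, h⟩ := right_extension_of_mem_maxSub hk hw hc
      refine ⟨⟨m, c⟩, ⟨hm, ?_⟩, rfl, rfl⟩
      have := mem_stair.mp (hc.subset (List.mem_append_right _ (List.mem_singleton_self c)))
      split_ifs with h0
      · simpa using this
      · simpa using h.resolve_left h0
    · rintro ⟨⟨m, d⟩, ⟨hm, hd⟩, rfl, rfl⟩
      refine ⟨oddRun_mem_maxSub hm, ?_⟩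
      dsimp only at hm hd ⊢
      split_ifs at hd with h0
      · subst h0
        exact singleton_isInfix_stair (Finset.mem_range.mp hd)
      · rcases (by simpa using hd : d = 2 * m ∨ d = 2 * m + 1) with rfl | rfl
        · exact oddRun_append_even_isInfix hm.le
        · exact oddRun_append_odd_isInfix hm
  rw [eR, hE, Set.ncard_coe_finset, Finset.card_map, Finset.card_sigma]
  obtain ⟨K, rfl⟩ := Nat.exists_eq_add_of_le' hk
  simp [Finset.sum_range_succ']
  omega

lemma finite_left_extensions {α : Type*} (T : List α) :
    {p : α × List α | p.2 ∈ MaxSub T ∧ Substr T (p.1 :: p.2)}.Finite := by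
  have hinj : Function.Injective fun p : α × List α => p.1 :: p.2 := by
    rintro ⟨a, b⟩ ⟨a', b'⟩ h
    simpa using h
  refine ((List.finite_toSet T.sublists).preimage hinj.injOn).subset ?_
  rintro p ⟨-, hp⟩
  simpa using (substr_iff_isInfix.mp hp).sublist

lemma two_mul_sum_range_succ_sub (K : ℕ) :
    2 * ∑ m ∈ Finset.range K, (K + 1 - m) = K * (K + 3) := by
  induction K with
  | zero => simp
  | succ K ih =>
    have h : ∀ m, K + 1 + 1 - (m + 1) = K + 1 - m := fun m => by omega
    simp only [Finset.sum_range_succ', h, mul_add, ih]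
    ring_nf
    omega

lemma length_stair_le_eL {k : ℕ} (hk : 1 ≤ k) : (stair k).length ≤ eL (stair k) := by
  let E : Finset (Σ _ : ℕ, ℕ) := (Finset.range k).sigma fun m =>
    if m = 0 then Finset.range (2 * k + 1) else (Finset.Ico (m - 1) k).image (2 * ·)
  have hinj : Function.Injective fun p : Σ _ : ℕ, ℕ => (p.2, oddRun p.1) := by
    rintro ⟨a, b⟩ ⟨a', b'⟩ h
    simp only [Prod.mk.injEq, oddRun_injective.eq_iff] at h
    rw [h.1, h.2]
  have hE : ↑(E.map ⟨_, hinj⟩) ⊆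
      {p : ℕ × List ℕ | p.2 ∈ MaxSub (stair k) ∧ Substr (stair k) (p.1 :: p.2)} := by
    rintro ⟨c, w⟩
    simp only [substr_iff_isInfix, Set.mem_ofPred_eq, Finset.coe_map, Function.Embedding.coeFn_mk,
      Set.mem_image, Finset.mem_coe, E, Finset.mem_sigma, Finset.mem_range, Prod.mk.injEq]
    rintro ⟨⟨m, d⟩, ⟨hm, hd⟩, rfl, rfl⟩
    refine ⟨oddRun_mem_maxSub hm, ?_⟩
    dsimp only at hm hd ⊢
    split_ifs at hd with h0
    · subst h0
      exact singleton_isInfix_stair (Finset.mem_range.mp hd)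
    · obtain ⟨i, hi, rfl⟩ := Finset.mem_image.mp hd
      rw [Finset.mem_Ico] at hi
      exact even_cons_oddRun_isInfix (by omega) hi.2
  have hcard := Set.ncard_le_ncard hE (finite_left_extensions _)
  rw [Set.ncard_coe_finset, Finset.card_map, Finset.card_sigma] at hcard
  refine le_trans ?_ hcard
  obtain ⟨K, rfl⟩ := Nat.exists_eq_add_of_le' hk
  have himage : ∀ s : Finset ℕ, (s.image (2 * ·)).card = s.card := fun s =>
    Finset.card_image_of_injective s fun a b h => by simpa using h
  simp only [Finset.sum_range_succ', Nat.add_eq_zero_iff, one_ne_zero, and_false, if_false,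
    himage, Nat.card_Ico, Nat.add_sub_cancel, if_true, Finset.card_range]
  have h1 := length_stair (K + 1)
  have h2 := two_mul_sum_range_succ_sub K
  nlinarith

theorem exists_string_eL_large_eR_small (k : ℕ) (hk : 1 ≤ k) :
    ∃ T : List ℕ, T.length = (k + 1) * (k + 2) / 2 ∧
      T.length ≤ eL T ∧
      eR T = 4 * k - 1 ∧
      (eR T) ^ 2 ≤ 32 * T.length := by
  have hlen := length_stair k
  refine ⟨stair k, by omega, length_stair_le_eL hk, eR_stair hk, ?_⟩
  rw [eR_stair hk]
  calc (4 * k - 1) ^ 2 ≤ (4 * k) ^ 2 := Nat.pow_le_pow_left (Nat.sub_le _ _) 2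
    _ ≤ 32 * (stair k).length := by nlinarith
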